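/- arXiv:2305.17867 — 5 statements merged into one kernel-verified Lean document; each statement's English description precedes it below -/
import Mathlib

section
/- For every i ∈ {1, 2, …, N(p−c)}, one has ν(h(i)) = ν(h(1)) + ν(i). -/
open scoped BigOperators

def Mfin (d t : ℕ) : Finset (Fin d → ℕ) :=
  (Fintype.piFinset fun _ : Fin d => Finset.range (t + 1)).filter fun q => ∑ i, q i ≤ t

def Nc (d t : ℕ) : ℕ := (Mfin d t).card

structure GradedOrdering (d : ℕ) where
  toEquiv : ℕ+ ≃ (Fin d → ℕ)
  map_one : toEquiv 1 = 0
  graded : ∀ i j : ℕ+, (∑ k, toEquiv i k) < (∑ k, toEquiv j k) → i < j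
  compat : ∀ i j k : ℕ+, i < j →
    toEquiv.symm (toEquiv i + toEquiv k) < toEquiv.symm (toEquiv j + toEquiv k)

open Classical in
noncomputable def bcoef {d : ℕ} (a : (Fin d → ℕ) → ℂ) (c : ℕ) (n m : Fin d → ℕ) : ℂ :=
  if n ≤ m ∧ m - n ∈ Mfin d c then a (m - n) else 0

noncomputable def hIdx {d : ℕ} (a : (Fin d → ℕ) → ℂ) (c p : ℕ) (ν : GradedOrdering d)
    (i : ℕ+) : ℕ+ :=
  (sSup {l : ℕ | 0 < l ∧ l ≤ Nc d p ∧
    bcoef a c (ν.toEquiv i) (ν.toEquiv l.toPNat') ≠ 0}).toPNat'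

def barSet {d : ℕ} (a : (Fin d → ℕ) → ℂ) (c p : ℕ) (ν : GradedOrdering d) : Set ℕ+ :=
  {l | ∃ i : ℕ+, (i : ℕ) ≤ Nc d (p - c) ∧ hIdx a c p ν i = l}

open Classical in
noncomputable def Jfin {d : ℕ} (a : (Fin d → ℕ) → ℂ) (c p : ℕ) (ν : GradedOrdering d) :
    Finset ℕ+ :=
  ((Finset.range (Nc d p)).filter fun l => l.succPNat ∉ barSet a c p ν).image Nat.succPNat

noncomputable def Pbar {d : ℕ} (a : (Fin d → ℕ) → ℂ) (c p : ℕ) (ν : GradedOrdering d) :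
    Matrix (Fin (Nc d (p - c))) (Fin (Nc d (p - c))) ℂ :=
  Matrix.of fun i j =>
    bcoef a c (ν.toEquiv i.val.succPNat) (ν.toEquiv (hIdx a c p ν j.val.succPNat))

open Classical in
noncomputable def Mdec {d : ℕ} (a : (Fin d → ℕ) → ℂ) (c p : ℕ) (ν : GradedOrdering d)
    (i s : ℕ+) : ℂ :=
  if hr : ∃ r : Fin (Nc d (p - c)), hIdx a c p ν r.val.succPNat = i then
    -∑ r₂ : Fin (Nc d (p - c)), (Pbar a c p ν)⁻¹ hr.choose r₂ *
      bcoef a c (ν.toEquiv r₂.val.succPNat) (ν.toEquiv s)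
  else if i = s then (1 : ℂ) else 0

noncomputable def pderiv' {d : ℕ} (i : Fin d) (f : (Fin d → ℝ) → ℂ) : (Fin d → ℝ) → ℂ :=
  fun x => fderiv ℝ f x (Pi.single i 1)

noncomputable def mderiv {d : ℕ} (m : Fin d → ℕ) (f : (Fin d → ℝ) → ℂ) :
    (Fin d → ℝ) → ℂ :=
  (List.finRange d).foldr (fun i g => (pderiv' i)^[m i] g) f

open Classical in
noncomputable def Tmat {d : ℕ} (ν : GradedOrdering d) (hv : Fin d → ℝ) (n i : ℕ+) : ℂ :=
  if ν.toEquiv i ≤ ν.toEquiv n then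
    ∏ k, (((hv k : ℝ) : ℂ) ^ ((ν.toEquiv n - ν.toEquiv i) k) /
      (((ν.toEquiv n - ν.toEquiv i) k).factorial : ℂ))
  else 0

noncomputable def alphaVec {d : ℕ} (ν : GradedOrdering d) (y c₁ : Fin d → ℝ) (n : ℕ+) : ℂ :=
  ∏ k, (((c₁ k - y k : ℝ) : ℂ) ^ (ν.toEquiv n k) / ((ν.toEquiv n k).factorial : ℂ))

theorem mem_Mfin {d t : ℕ} {q : Fin d → ℕ} : q ∈ Mfin d t ↔ ∑ i, q i ≤ t := by
  simp only [Mfin, Finset.mem_filter, Fintype.mem_piFinset, Finset.mem_range, Nat.lt_succ_iff,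
    and_iff_right_iff_imp]
  intro h k
  exact (Finset.single_le_sum (f := q) (fun _ _ => Nat.zero_le _) (Finset.mem_univ k)).trans h

namespace GradedOrdering

variable {d : ℕ} (ν : GradedOrdering d)

/-- The first `N(t)` multi-indices in a graded ordering are those of total degree at most `t`. -/
theorem le_Nc_iff (t : ℕ) (i : ℕ+) : (i : ℕ) ≤ Nc d t ↔ ∑ k, ν.toEquiv i k ≤ t := by
  set s : Finset ℕ+ := (Mfin d t).map ν.toEquiv.symm.toEmbedding with hs
  have mem_s (j : ℕ+) : j ∈ s ↔ ∑ k, ν.toEquiv j k ≤ t := by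
    simp [hs, Finset.mem_map_equiv, mem_Mfin]
  have lower {j l : ℕ+} (hl : l ∈ s) (hjl : j ≤ l) : j ∈ s := by
    rw [mem_s] at hl ⊢
    by_contra! hj
    exact hjl.not_gt (ν.graded _ _ (hl.trans_lt hj))
  have card_s : Nc d t = s.card := (Finset.card_map _).symm
  rw [← mem_s, card_s]
  constructor
  · intro hi
    by_contra his
    have hsub : s ⊆ Finset.Ico 1 i := fun j hj =>
      Finset.mem_Ico.2 ⟨one_le, lt_of_not_ge fun hij => his (lower hj hij)⟩
    have hcard := Finset.card_le_card hsub
    have hpos := i.pos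
    rw [PNat.card_Ico, PNat.one_coe] at hcard
    omega
  · intro hi
    have hsub : Finset.Icc 1 i ⊆ s := fun j hj => lower hi (Finset.mem_Icc.1 hj).2
    have hcard := Finset.card_le_card hsub
    rw [PNat.card_Icc, PNat.one_coe] at hcard
    omega

theorem symm_add_le_symm_add {m n : Fin d → ℕ} (h : ν.toEquiv.symm m ≤ ν.toEquiv.symm n)
    (q : Fin d → ℕ) : ν.toEquiv.symm (m + q) ≤ ν.toEquiv.symm (n + q) := by
  rcases h.eq_or_lt with h | h
  · rw [ν.toEquiv.symm.injective h]
  · simpa using (ν.compat _ _ (ν.toEquiv.symm q) h).le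

end GradedOrdering

theorem bcoef_add_right {d : ℕ} (a : (Fin d → ℕ) → ℂ) {c : ℕ} {m : Fin d → ℕ}
    (hm : m ∈ Mfin d c) (n : Fin d → ℕ) : bcoef a c n (m + n) = a m := by
  rw [bcoef, add_tsub_cancel_right, if_pos ⟨le_add_self, hm⟩]

theorem exists_of_bcoef_ne_zero {d : ℕ} {a : (Fin d → ℕ) → ℂ} {c : ℕ} {n q : Fin d → ℕ}
    (h : bcoef a c n q ≠ 0) : ∃ m ∈ Mfin d c, a m ≠ 0 ∧ q = m + n := by
  rw [bcoef] at h
  split_ifs at h with hq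
  · exact ⟨q - n, hq.2, h, (tsub_add_cancel_of_le hq.1).symm⟩
  · exact absurd rfl h

/-- If `m` is the leading exponent of `a`, then row `i` has its last nonzero entry in the column
indexed by `m + ν(i)`. -/
theorem toEquiv_hIdx {d p c : ℕ} (hpc : c ≤ p) (ν : GradedOrdering d) (a : (Fin d → ℕ) → ℂ)
    {m : Fin d → ℕ} (hm : m ∈ Mfin d c) (ham : a m ≠ 0)
    (hmax : ∀ n ∈ Mfin d c, a n ≠ 0 → ν.toEquiv.symm n ≤ ν.toEquiv.symm m)
    {i : ℕ+} (hi : ∑ k, ν.toEquiv i k ≤ p - c) :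
    ν.toEquiv (hIdx a c p ν i) = m + ν.toEquiv i := by
  have hgreatest : IsGreatest {l : ℕ | 0 < l ∧ l ≤ Nc d p ∧
      bcoef a c (ν.toEquiv i) (ν.toEquiv l.toPNat') ≠ 0}
      (ν.toEquiv.symm (m + ν.toEquiv i) : ℕ) := by
    refine ⟨⟨PNat.pos _, ?_, ?_⟩, ?_⟩
    · have hdeg := mem_Mfin.1 hm
      simp only [ν.le_Nc_iff, Equiv.apply_symm_apply, Pi.add_apply, Finset.sum_add_distrib]
      omega
    · rwa [PNat.coe_toPNat', Equiv.apply_symm_apply, bcoef_add_right a hm]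
    · rintro l ⟨hl, -, hb⟩
      obtain ⟨n, hn, han, hln⟩ := exists_of_bcoef_ne_zero hb
      have hle := ν.symm_add_le_symm_add (hmax n hn han) (ν.toEquiv i)
      rw [← hln, Equiv.symm_apply_apply, ← PNat.coe_le_coe, Nat.toPNat'_coe, if_pos hl] at hle
      exact hle
  rw [hIdx, hgreatest.csSup_eq, PNat.coe_toPNat', Equiv.apply_symm_apply]

/-- For every `i ∈ {1,…,N(p−c)}`, one has `ν(h(i)) = ν(h(1)) + ν(i)`. -/
theorem h_eq {d p c : ℕ} (hd : 1 ≤ d) (hc : 1 ≤ c) (hpc : c ≤ p)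
    (ν : GradedOrdering d) (a : (Fin d → ℕ) → ℂ)
    (ha : ∃ m ∈ Mfin d c, (∑ i, m i) = c ∧ a m ≠ 0) :
    ∀ i : ℕ+, (i : ℕ) ≤ Nc d (p - c) →
      ν.toEquiv (hIdx a c p ν i) = ν.toEquiv (hIdx a c p ν 1) + ν.toEquiv i := by
  intro i hi
  classical
  obtain ⟨m₀, hm₀, -, ham₀⟩ := ha
  obtain ⟨m, hm, hmax⟩ := ((Mfin d c).filter fun n => a n ≠ 0).exists_max_image ν.toEquiv.symm
    ⟨m₀, Finset.mem_filter.2 ⟨hm₀, ham₀⟩⟩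
  obtain ⟨hmc, ham⟩ := Finset.mem_filter.1 hm
  have hmax' : ∀ n ∈ Mfin d c, a n ≠ 0 → ν.toEquiv.symm n ≤ ν.toEquiv.symm m :=
    fun n hn han => hmax n (Finset.mem_filter.2 ⟨hn, han⟩)
  have hone : ∑ k, ν.toEquiv 1 k ≤ p - c := by simp [ν.map_one]
  rw [toEquiv_hIdx hpc ν a hmc ham hmax' ((ν.le_Nc_iff _ _).1 hi),
    toEquiv_hIdx hpc ν a hmc ham hmax' hone, ν.map_one, add_zero]
end

section
/- The square submatrix of P obtained by selecting, in order, the columns with indices h(1), h(2), …, h(N(p−c)) is lower triangular with nonzero diagonal entries, and is therefore invertible. -/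
open scoped BigOperators

/-- An index is at most `N(t)` exactly when it enumerates a multi-index of degree at most `t`. -/
theorem GradedOrdering.le_Nc_iff_s7 {d : ℕ} (ν : GradedOrdering d) (t : ℕ) (i : ℕ+) :
    (i : ℕ) ≤ Nc d t ↔ ν.toEquiv i ∈ Mfin d t := by
  constructor
  · intro hi
    by_contra h
    rw [mem_Mfin, not_le] at h
    have hle : Nc d t ≤ (Finset.Ico 1 i).card := by
      refine Finset.card_le_card_of_injOn ν.toEquiv.symm (fun q hq => ?_)
        ν.toEquiv.symm.injective.injOn
      simp only [Finset.coe_Ico, Set.mem_Ico, one_le, true_and]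
      refine ν.graded _ _ ?_
      rw [Equiv.apply_symm_apply]
      exact (mem_Mfin.mp hq).trans_lt h
    rw [PNat.card_Ico, PNat.one_coe] at hle
    have := i.pos
    omega
  · intro h
    have hle : (Finset.Icc 1 i).card ≤ Nc d t := by
      refine Finset.card_le_card_of_injOn ν.toEquiv (fun j hj => ?_) ν.toEquiv.injective.injOn
      simp only [Finset.coe_Icc, Set.mem_Icc, one_le, true_and] at hj
      refine mem_Mfin.mpr (le_of_not_gt fun hlt => ?_)
      exact hj.not_gt (ν.graded _ _ ((mem_Mfin.mp h).trans_lt hlt))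
    rw [PNat.card_Icc, PNat.one_coe] at hle
    omega

theorem bcoef_ne_zero_iff {d c : ℕ} {a : (Fin d → ℕ) → ℂ} {n m : Fin d → ℕ} :
    bcoef a c n m ≠ 0 ↔ ∃ q ∈ Mfin d c, a q ≠ 0 ∧ m = n + q := by
  unfold bcoef
  constructor
  · intro h
    split_ifs at h with hm
    · exact ⟨m - n, hm.2, h, (add_tsub_cancel_of_le hm.1).symm⟩
    · exact absurd rfl h
  · rintro ⟨q, hq, haq, rfl⟩
    simpa [hq] using haq

theorem hIdx_isGreatest {d p c : ℕ} (hpc : c ≤ p) (ν : GradedOrdering d)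
    {a : (Fin d → ℕ) → ℂ} (ha : ∃ q ∈ Mfin d c, a q ≠ 0) {i : ℕ+} (hi : (i : ℕ) ≤ Nc d (p - c)) :
    IsGreatest {l : ℕ+ | bcoef a c (ν.toEquiv i) (ν.toEquiv l) ≠ 0} (hIdx a c p ν i) := by
  set S : Set ℕ := {l : ℕ | 0 < l ∧ l ≤ Nc d p ∧
    bcoef a c (ν.toEquiv i) (ν.toEquiv l.toPNat') ≠ 0}
  have hmem : ∀ l : ℕ+, bcoef a c (ν.toEquiv i) (ν.toEquiv l) ≠ 0 → (l : ℕ) ∈ S := by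
    intro l hl
    refine ⟨l.pos, (ν.le_Nc_iff_s7 p l).mpr ?_, by simpa using hl⟩
    obtain ⟨q, hq, -, hlq⟩ := bcoef_ne_zero_iff.mp hl
    have hdeg := mem_Mfin.mp ((ν.le_Nc_iff_s7 _ i).mp hi)
    rw [hlq, mem_Mfin]
    simp only [Pi.add_apply, Finset.sum_add_distrib]
    have := mem_Mfin.mp hq
    omega
  have hbdd : BddAbove S := ⟨Nc d p, fun _ hl => hl.2.1⟩
  obtain ⟨q, hq, haq⟩ := ha
  have hne : S.Nonempty := ⟨_, hmem (ν.toEquiv.symm (ν.toEquiv i + q))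
    (bcoef_ne_zero_iff.mpr ⟨q, hq, haq, by simp⟩)⟩
  have hsup := Nat.sSup_mem hne hbdd
  refine ⟨hsup.2.2, fun l hl => ?_⟩
  have hle := le_csSup hbdd (hmem l hl)
  rw [← PNat.coe_le_coe, hIdx, Nat.toPNat'_coe, if_pos hsup.1]
  exact hle

/-- The square submatrix of `P` formed (in order) by the columns
`h(1), …, h(N(p−c))` is lower triangular with nonzero diagonal entries, and is therefore
invertible. -/
theorem Pbar_lowerTriangular_invertible {d p c : ℕ} (hd : 1 ≤ d) (hc : 1 ≤ c) (hpc : c ≤ p)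
    (ν : GradedOrdering d) (a : (Fin d → ℕ) → ℂ)
    (ha : ∃ m ∈ Mfin d c, (∑ i, m i) = c ∧ a m ≠ 0) :
    (∀ i j : Fin (Nc d (p - c)), i < j → Pbar a c p ν i j = 0)
    ∧ (∀ i : Fin (Nc d (p - c)), Pbar a c p ν i i ≠ 0)
    ∧ IsUnit (Pbar a c p ν) := by
  have ha' : ∃ q ∈ Mfin d c, a q ≠ 0 := ha.imp fun _ hm => ⟨hm.1, hm.2.2⟩
  have hgreatest (i : Fin (Nc d (p - c))) :=
    hIdx_isGreatest hpc ν ha' (i := i.val.succPNat) (by simp)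
  have hlower : ∀ i j : Fin (Nc d (p - c)), i < j → Pbar a c p ν i j = 0 := by
    intro i j hij
    by_contra hne
    obtain ⟨q, hq, haq, hjq⟩ := bcoef_ne_zero_iff.mp hne
    have hle := mem_upperBounds.mp (hgreatest j).2 (ν.toEquiv.symm (ν.toEquiv j.val.succPNat + q))
      (bcoef_ne_zero_iff.mpr ⟨q, hq, haq, by simp⟩)
    have hlt := ν.compat i.val.succPNat j.val.succPNat (ν.toEquiv.symm q)
      (Nat.succPNat_lt_succPNat.mpr hij)
    rw [Equiv.apply_symm_apply, ← hjq, Equiv.symm_apply_apply] at hlt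
    exact hle.not_gt hlt
  have hdiag : ∀ i : Fin (Nc d (p - c)), Pbar a c p ν i i ≠ 0 := fun i => (hgreatest i).1
  refine ⟨hlower, hdiag, ?_⟩
  rw [Matrix.isUnit_iff_isUnit_det, Matrix.det_of_isLowerTriangular _ fun i j hij => hlower i j hij,
    isUnit_iff_ne_zero]
  exact Finset.prod_ne_zero_iff.mpr fun i _ => hdiag i
end

section
/- The set of represented indices {1,…,N(p)} ∖ {h(1),…,h(N(p−c))} has cardinality exactly N(p) − N(p−c) = C(p+d, d) − C(p−c+d, d). Moreover, this quantity is at most c · C(p+d−1, d−1). -/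
open scoped BigOperators

theorem card_piAntidiag_univ_fin (d s : ℕ) :
    (Finset.piAntidiag (Finset.univ : Finset (Fin d)) s).card = d.multichoose s := by
  have hmap : Finset.piAntidiag Finset.univ s =
      (Finset.finsuppAntidiag (Finset.univ : Finset (Fin d)) s).map
        Finsupp.equivFunOnFinite.toEmbedding := by
    ext q
    simp [Finset.mem_map_equiv]
  rw [hmap, Finset.card_map, Finset.card_finsuppAntidiag_nat_eq_multichoose, Finset.card_fin]

theorem Mfin_eq_biUnion_piAntidiag (d t : ℕ) :
    Mfin d t = (Finset.range (t + 1)).biUnion (Finset.piAntidiag Finset.univ) := by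
  ext q
  simp [mem_Mfin]

theorem Nc_eq_choose (d t : ℕ) : Nc d t = (t + d).choose d := by
  rw [Nc, Mfin_eq_biUnion_piAntidiag, Finset.card_biUnion fun s _ r _ hsr => ?_]
  · simp only [card_piAntidiag_univ_fin, Nat.sum_range_multichoose]
  · exact Finset.disjoint_left.2 fun q hs hr =>
      hsr ((Finset.mem_piAntidiag.1 hs).1.symm.trans (Finset.mem_piAntidiag.1 hr).1)

theorem choose_add_le_add_mul_choose (q c e : ℕ) :
    (q + c + (e + 1)).choose (e + 1) ≤ (q + (e + 1)).choose (e + 1) + c * (q + c + e).choose e := by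
  induction c with
  | zero => simp
  | succ c ih =>
    have pascal : (q + (c + 1) + (e + 1)).choose (e + 1) =
        (q + (c + 1) + e).choose e + (q + c + (e + 1)).choose (e + 1) := by
      rw [show q + (c + 1) + (e + 1) = (q + (c + 1) + e) + 1 by ring, Nat.choose_succ_succ,
        show q + (c + 1) + e = q + c + (e + 1) by ring]
    have mono : (q + c + e).choose e ≤ (q + (c + 1) + e).choose e :=
      Nat.choose_le_choose e (by omega)
    rw [pascal]
    nlinarith [Nat.mul_le_mul_left c mono]

theorem mem_iff_coe_le_card_of_isLowerSet {S : Finset ℕ+} (hS : IsLowerSet (S : Set ℕ+)) (l : ℕ+) :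
    l ∈ S ↔ (l : ℕ) ≤ S.card := by
  constructor
  · intro hl
    have hsub : Finset.Icc 1 l ⊆ S := fun k hk => hS (Finset.mem_Icc.1 hk).2 hl
    simpa using Finset.card_le_card hsub
  · intro hl
    by_contra hlS
    have hsub : S ⊆ Finset.Ico 1 l := fun k hk =>
      Finset.mem_Ico.2 ⟨one_le, lt_of_not_ge fun hlk => hlS (hS hlk hk)⟩
    have hcard := Finset.card_le_card hsub
    rw [PNat.card_Ico, PNat.one_coe] at hcard
    have := l.pos
    omega

theorem finite_setOf_coe_le (n : ℕ) : {l : ℕ+ | (l : ℕ) ≤ n}.Finite :=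
  (Set.finite_Iic n).preimage PNat.coe_injective.injOn

theorem ncard_setOf_coe_le (n : ℕ) : {l : ℕ+ | (l : ℕ) ≤ n}.ncard = n := by
  have : {l : ℕ+ | (l : ℕ) ≤ n} = Nat.succPNat '' (Finset.range n : Set ℕ) := by
    ext l
    simp only [Set.mem_ofPred_eq, Set.mem_image, Finset.mem_coe, Finset.mem_range]
    refine ⟨fun h => ⟨l.natPred, ?_, PNat.succPNat_natPred l⟩, ?_⟩
    · have := PNat.natPred_add_one l
      omega
    · rintro ⟨k, hk, rfl⟩
      exact hk
  rw [this, Set.ncard_image_of_injective _ Nat.succPNat_injective, Set.ncard_coe_finset,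
    Finset.card_range]

namespace GradedOrdering

variable {d : ℕ} (ν : GradedOrdering d)

theorem coe_le_Nc_iff (t : ℕ) (l : ℕ+) : (l : ℕ) ≤ Nc d t ↔ ∑ k, ν.toEquiv l k ≤ t := by
  have hmem (k : ℕ+) : k ∈ (Mfin d t).map ν.toEquiv.symm.toEmbedding ↔
      ∑ i, ν.toEquiv k i ≤ t := by
    rw [Finset.mem_map_equiv, Equiv.symm_symm, mem_Mfin]
  have hlower : IsLowerSet ((Mfin d t).map ν.toEquiv.symm.toEmbedding : Set ℕ+) := by
    intro i j hji hi
    rw [Finset.mem_coe, hmem] at hi ⊢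
    exact (le_of_not_gt fun h => hji.not_gt (ν.graded i j h)).trans hi
  rw [← hmem, mem_iff_coe_le_card_of_isLowerSet hlower, Finset.card_map, Nc]

/-- The index of `ν i + ν k`. -/
def addIdx (i k : ℕ+) : ℕ+ := ν.toEquiv.symm (ν.toEquiv i + ν.toEquiv k)

theorem toEquiv_addIdx (i k : ℕ+) :
    ν.toEquiv (ν.addIdx i k) = ν.toEquiv i + ν.toEquiv k :=
  ν.toEquiv.apply_symm_apply _

theorem addIdx_left_injective (k : ℕ+) : Function.Injective fun i => ν.addIdx i k :=
  fun _ _ h => ν.toEquiv.injective (add_right_cancel (ν.toEquiv.symm.injective h))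

theorem addIdx_mono_right (i : ℕ+) : Monotone (ν.addIdx i) := by
  refine StrictMono.monotone fun j k hjk => ?_
  simpa only [addIdx, add_comm (ν.toEquiv i)] using ν.compat j k i hjk

theorem exists_leading_index {a : (Fin d → ℕ) → ℂ} {c : ℕ} (ha : ∃ m ∈ Mfin d c, a m ≠ 0) :
    ∃ k, IsGreatest {k : ℕ+ | ν.toEquiv k ∈ Mfin d c ∧ a (ν.toEquiv k) ≠ 0} k := by
  obtain ⟨m, hm, ham⟩ := ha
  have hfin : {k : ℕ+ | ν.toEquiv k ∈ Mfin d c ∧ a (ν.toEquiv k) ≠ 0}.Finite :=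
    ((Mfin d c).finite_toSet.preimage ν.toEquiv.injective.injOn).subset fun k hk => hk.1
  obtain ⟨k, hk⟩ := hfin.exists_maximal ⟨ν.toEquiv.symm m, by simpa using ⟨hm, ham⟩⟩
  exact ⟨k, hk.prop, fun j hj => (le_total j k).elim id (hk.le_of_ge hj)⟩

theorem bcoef_addIdx (a : (Fin d → ℕ) → ℂ) {c : ℕ} (i : ℕ+) {k : ℕ+}
    (hk : ν.toEquiv k ∈ Mfin d c) :
    bcoef a c (ν.toEquiv i) (ν.toEquiv (ν.addIdx i k)) = a (ν.toEquiv k) := by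
  rw [toEquiv_addIdx, bcoef, add_tsub_cancel_left, if_pos ⟨le_self_add, hk⟩]

theorem exists_eq_addIdx_of_bcoef_ne_zero {a : (Fin d → ℕ) → ℂ} {c : ℕ} {i l : ℕ+}
    (h : bcoef a c (ν.toEquiv i) (ν.toEquiv l) ≠ 0) :
    ∃ k, (ν.toEquiv k ∈ Mfin d c ∧ a (ν.toEquiv k) ≠ 0) ∧ l = ν.addIdx i k := by
  unfold bcoef at h
  split_ifs at h with hle
  · refine ⟨ν.toEquiv.symm (ν.toEquiv l - ν.toEquiv i), ?_, ?_⟩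
    · simpa using ⟨hle.2, h⟩
    · simp [addIdx, add_tsub_cancel_of_le hle.1]
  · exact absurd rfl h

theorem addIdx_le_Nc {c p : ℕ} (hcp : c ≤ p) {i k : ℕ+} (hi : (i : ℕ) ≤ Nc d (p - c))
    (hk : ν.toEquiv k ∈ Mfin d c) : (ν.addIdx i k : ℕ) ≤ Nc d p := by
  rw [coe_le_Nc_iff ν] at hi ⊢
  rw [mem_Mfin] at hk
  simp only [toEquiv_addIdx, Pi.add_apply, Finset.sum_add_distrib]
  omega

theorem hIdx_eq_addIdx {a : (Fin d → ℕ) → ℂ} {c p : ℕ} (hcp : c ≤ p) {k : ℕ+}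
    (hk : IsGreatest {k : ℕ+ | ν.toEquiv k ∈ Mfin d c ∧ a (ν.toEquiv k) ≠ 0} k)
    {i : ℕ+} (hi : (i : ℕ) ≤ Nc d (p - c)) : hIdx a c p ν i = ν.addIdx i k := by
  have hgreatest : IsGreatest {l : ℕ | 0 < l ∧ l ≤ Nc d p ∧
      bcoef a c (ν.toEquiv i) (ν.toEquiv l.toPNat') ≠ 0} (ν.addIdx i k) := by
    refine ⟨⟨PNat.pos _, ν.addIdx_le_Nc hcp hi hk.1.1, ?_⟩, ?_⟩
    · rw [PNat.coe_toPNat', bcoef_addIdx ν a i hk.1.1]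
      exact hk.1.2
    · rintro l ⟨hl, -, hb⟩
      lift l to ℕ+ using hl
      rw [PNat.coe_toPNat'] at hb
      obtain ⟨j, hj, rfl⟩ := ν.exists_eq_addIdx_of_bcoef_ne_zero hb
      exact PNat.coe_le_coe _ _ |>.2 (ν.addIdx_mono_right i (hk.2 hj))
  rw [hIdx, hgreatest.csSup_eq, PNat.coe_toPNat']

theorem barSet_eq_image_addIdx {a : (Fin d → ℕ) → ℂ} {c p : ℕ} (hcp : c ≤ p) {k : ℕ+}
    (hk : IsGreatest {k : ℕ+ | ν.toEquiv k ∈ Mfin d c ∧ a (ν.toEquiv k) ≠ 0} k) :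
    barSet a c p ν = (fun i => ν.addIdx i k) '' {i : ℕ+ | (i : ℕ) ≤ Nc d (p - c)} := by
  ext l
  exact exists_congr fun i => and_congr_right fun hi => by rw [ν.hIdx_eq_addIdx hcp hk hi]

theorem ncard_diff_barSet {a : (Fin d → ℕ) → ℂ} {c p : ℕ} (hcp : c ≤ p)
    (ha : ∃ m ∈ Mfin d c, a m ≠ 0) :
    ({l : ℕ+ | (l : ℕ) ≤ Nc d p} \ barSet a c p ν).ncard = Nc d p - Nc d (p - c) := by
  obtain ⟨k, hk⟩ := ν.exists_leading_index ha
  have hsub : (fun i => ν.addIdx i k) '' {i : ℕ+ | (i : ℕ) ≤ Nc d (p - c)} ⊆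
      {l : ℕ+ | (l : ℕ) ≤ Nc d p} := by
    rintro _ ⟨i, hi, rfl⟩
    exact ν.addIdx_le_Nc hcp hi hk.1.1
  rw [ν.barSet_eq_image_addIdx hcp hk, Set.ncard_sdiff' hsub (finite_setOf_coe_le _),
    ncard_setOf_coe_le, Set.ncard_image_of_injective _ (ν.addIdx_left_injective k),
    ncard_setOf_coe_le]

end GradedOrdering

/-- The set of represented indices `{1,…,N(p)} ∖ {h(1),…,h(N(p−c))}` has
cardinality exactly `N(p) − N(p−c) = C(p+d,d) − C(p−c+d,d)`, and this quantity is at most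
`c · C(p+d−1, d−1)`. -/
theorem represented_count {d p c : ℕ} (hd : 1 ≤ d) (hc : 1 ≤ c) (hpc : c ≤ p)
    (ν : GradedOrdering d) (a : (Fin d → ℕ) → ℂ)
    (ha : ∃ m ∈ Mfin d c, (∑ i, m i) = c ∧ a m ≠ 0) :
    ({l : ℕ+ | (l : ℕ) ≤ Nc d p} \ barSet a c p ν).ncard = Nc d p - Nc d (p - c)
    ∧ Nc d p - Nc d (p - c) = (p + d).choose d - (p - c + d).choose d
    ∧ Nc d p - Nc d (p - c) ≤ c * (p + d - 1).choose (d - 1) := by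
  obtain ⟨m, hm, -, ham⟩ := ha
  refine ⟨ν.ncard_diff_barSet hpc ⟨m, hm, ham⟩, by rw [Nc_eq_choose, Nc_eq_choose], ?_⟩
  obtain ⟨e, rfl⟩ := Nat.exists_eq_add_of_le' hd
  obtain ⟨q, rfl⟩ := Nat.exists_eq_add_of_le' hpc
  rw [Nc_eq_choose, Nc_eq_choose, Nat.sub_le_iff_le_add', Nat.add_sub_cancel]
  exact choose_add_le_add_mul_choose q c e
end

section
/- Suppose a_m = 0 whenever |m| < c (the partial differential operator has only terms of equal order c). Let G : ℝ^d ∖ {0} → ℂ be p-times continuously differentiable with Σ_{m ∈ M(c)} a_m ∂^m G = 0 on ℝ^d ∖ {0}. Let y, c₁, c₂ ∈ ℝ^d, set h = c₂ − c₁, let α ∈ ℂ^{N(p)} with α_n = (c₁ − y)^{ν(n)}/ν(n)!, let ρ = T α, and let σ = T E Mᵀ α, where T is the multipole-to-multipole translation matrix for shift h, M the decompression matrix, and E the embedding operator. Then for every z ∈ ℝ^d ∖ {0}: Σ_{n=1}^{N(p)} σ_n ∂^{ν(n)} G(z) = Σ_{n=1}^{N(p)} ρ_n ∂^{ν(n)}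 G(z). -/
open scoped BigOperators

/-! ### Iterated partial derivatives along lists of directions -/

/-- Iterated partial derivative along a list of coordinate directions. -/
noncomputable def listDeriv {d : ℕ} (L : List (Fin d)) (f : (Fin d → ℝ) → ℂ) :
    (Fin d → ℝ) → ℂ :=
  L.foldr pderiv' f

/-- The list of coordinate directions in which `mderiv m` differentiates. -/
def dirList {d : ℕ} (m : Fin d → ℕ) : List (Fin d) :=
  (List.finRange d).flatMap fun i => List.replicate (m i) i

theorem listDeriv_replicate {d : ℕ} (i : Fin d) (k : ℕ) (f : (Fin d → ℝ) → ℂ) :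
    listDeriv (List.replicate k i) f = (pderiv' i)^[k] f := by
  induction k with
  | zero => rfl
  | succ k ih =>
    rw [Function.iterate_succ_apply', ← ih]
    rfl

theorem listDeriv_append {d : ℕ} (L L' : List (Fin d)) (f : (Fin d → ℝ) → ℂ) :
    listDeriv (L ++ L') f = listDeriv L (listDeriv L' f) :=
  List.foldr_append

theorem mderiv_eq_listDeriv {d : ℕ} (m : Fin d → ℕ) (f : (Fin d → ℝ) → ℂ) :
    mderiv m f = listDeriv (dirList m) f := by
  unfold mderiv dirList
  induction List.finRange d with
  | nil => rfl
  | cons i L ih =>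
    rw [List.foldr_cons, List.flatMap_cons, listDeriv_append, listDeriv_replicate, ih]

theorem count_dirList {d : ℕ} (m : Fin d → ℕ) (i : Fin d) : (dirList m).count i = m i := by
  simp [dirList, List.count_flatMap, List.count_replicate, Function.comp_def,
    ← List.ofFn_eq_map, List.sum_ofFn]

theorem length_dirList {d : ℕ} (m : Fin d → ℕ) : (dirList m).length = ∑ i, m i := by
  simp [dirList, List.length_flatMap, ← List.ofFn_eq_map, List.sum_ofFn]

theorem dirList_add_perm {d : ℕ} (m n : Fin d → ℕ) :
    (dirList (m + n)).Perm (dirList m ++ dirList n) := by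
  rw [List.perm_iff_count]
  intro i
  simp [count_dirList]

section OpenSet

variable {d : ℕ} {U : Set (Fin d → ℝ)} {f g : (Fin d → ℝ) → ℂ}

theorem pderiv'_eqOn (hU : IsOpen U) (h : Set.EqOn f g U) (i : Fin d) :
    Set.EqOn (pderiv' i f) (pderiv' i g) U := by
  intro x hx
  unfold pderiv'
  rw [(h.eventuallyEq_of_mem (hU.mem_nhds hx)).fderiv_eq]

theorem listDeriv_eqOn (hU : IsOpen U) (h : Set.EqOn f g U) (L : List (Fin d)) :
    Set.EqOn (listDeriv L f) (listDeriv L g) U := by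
  induction L with
  | nil => exact h
  | cons i L ih => exact pderiv'_eqOn hU ih i

theorem contDiffOn_pderiv' (hU : IsOpen U) {k : ℕ} (hf : ContDiffOn ℝ (k + 1 : ℕ) f U)
    (i : Fin d) : ContDiffOn ℝ k (pderiv' i f) U :=
  (hf.fderiv_of_isOpen hU (by norm_cast)).clm_apply contDiffOn_const

theorem contDiffOn_listDeriv (hU : IsOpen U) (L : List (Fin d)) {k : ℕ}
    (hf : ContDiffOn ℝ (k + L.length : ℕ) f U) : ContDiffOn ℝ k (listDeriv L f) U := by
  induction L generalizing k with
  | nil => exact hf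
  | cons i L ih =>
    refine contDiffOn_pderiv' hU (ih ?_) i
    rw [List.length_cons] at hf
    convert hf using 2
    ring

theorem pderiv'_comm (hU : IsOpen U) (hf : ContDiffOn ℝ 2 f U) (i j : Fin d) :
    Set.EqOn (pderiv' i (pderiv' j f)) (pderiv' j (pderiv' i f)) U := by
  intro x hx
  have hfx : ContDiffAt ℝ 2 f x := hf.contDiffAt (hU.mem_nhds hx)
  have hd : DifferentiableAt ℝ (fderiv ℝ f) x :=
    (hfx.fderiv_right (m := 1) (by norm_num)).differentiableAt (by norm_num)
  have key : ∀ k l : Fin d, pderiv' k (pderiv' l f) x =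
      fderiv ℝ (fderiv ℝ f) x (Pi.single k 1) (Pi.single l 1) := by
    intro k l
    unfold pderiv'
    rw [fderiv_clm_apply hd (differentiableAt_const _)]
    simp
  rw [key, key]
  exact hfx.isSymmSndFDerivAt (by simp) _ _

theorem listDeriv_perm (hU : IsOpen U) {L L' : List (Fin d)} (h : L.Perm L')
    (hf : ContDiffOn ℝ L.length f U) :
    Set.EqOn (listDeriv L f) (listDeriv L' f) U := by
  induction h with
  | nil => exact fun _ _ => rfl
  | cons i _ ih =>
    exact pderiv'_eqOn hU (ih (hf.of_le (by simp))) i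
  | swap i j L =>
    refine pderiv'_comm hU (contDiffOn_listDeriv hU L (k := 2) ?_) j i
    rwa [add_comm]
  | trans h₁ _ ih₁ ih₂ =>
    exact (ih₁ hf).trans (ih₂ (h₁.length_eq ▸ hf))

theorem pderiv'_sum (hU : IsOpen U) {ι : Type*} (s : Finset ι) (a : ι → ℂ)
    (F : ι → (Fin d → ℝ) → ℂ) (hF : ∀ m ∈ s, ContDiffOn ℝ 1 (F m) U) (i : Fin d) :
    Set.EqOn (pderiv' i fun x => ∑ m ∈ s, a m * F m x)
      (fun x => ∑ m ∈ s, a m * pderiv' i (F m) x) U := by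
  intro x hx
  have hd : ∀ m ∈ s, DifferentiableAt ℝ (F m) x := fun m hm =>
    ((hF m hm).contDiffAt (hU.mem_nhds hx)).differentiableAt (by norm_num)
  unfold pderiv'
  rw [fderiv_fun_sum fun m hm => (hd m hm).const_mul (a m), sum_apply]
  refine Finset.sum_congr rfl fun m hm => ?_
  rw [fderiv_const_mul (hd m hm)]
  rfl

theorem listDeriv_sum (hU : IsOpen U) {ι : Type*} (s : Finset ι) (a : ι → ℂ)
    (F : ι → (Fin d → ℝ) → ℂ) (L : List (Fin d))
    (hF : ∀ m ∈ s, ContDiffOn ℝ L.length (F m) U) :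
    Set.EqOn (listDeriv L fun x => ∑ m ∈ s, a m * F m x)
      (fun x => ∑ m ∈ s, a m * listDeriv L (F m) x) U := by
  induction L with
  | nil => exact fun _ _ => rfl
  | cons i L ih =>
    refine (pderiv'_eqOn hU (ih fun m hm => (hF m hm).of_le (by simp)) i).trans ?_
    refine pderiv'_sum hU s a _ (fun m hm => contDiffOn_listDeriv hU L (k := 1) ?_) i
    convert hF m hm using 2
    simp [add_comm]

theorem listDeriv_zero (L : List (Fin d)) : listDeriv L (fun _ => 0) = fun _ => 0 := by
  induction L with
  | nil => rfl
  | cons i L ih =>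
    change pderiv' i (listDeriv L _) = _
    rw [ih]
    funext x
    simp [pderiv']

/-- Differentiating a constant-coefficient equation yields the shifted equation. -/
theorem sum_mul_mderiv_add_eq_zero (hU : IsOpen U) {p c : ℕ} (hf : ContDiffOn ℝ p f U)
    (s : Finset (Fin d → ℕ)) (hs : ∀ m ∈ s, ∑ i, m i ≤ c) (a : (Fin d → ℕ) → ℂ)
    (hPDE : ∀ x ∈ U, ∑ m ∈ s, a m * mderiv m f x = 0)
    (q : Fin d → ℕ) (hq : ∑ i, q i + c ≤ p) {x : Fin d → ℝ} (hx : x ∈ U) :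
    ∑ m ∈ s, a m * mderiv (q + m) f x = 0 := by
  have hsplit : ∀ m ∈ s, mderiv (q + m) f x = listDeriv (dirList q) (mderiv m f) x := by
    intro m hm
    rw [mderiv_eq_listDeriv, mderiv_eq_listDeriv m, ← listDeriv_append]
    refine listDeriv_perm hU (dirList_add_perm q m) (hf.of_le ?_) hx
    have := hs m hm
    rw [length_dirList]
    simp only [Pi.add_apply, Finset.sum_add_distrib]
    exact_mod_cast (by omega)
  rw [Finset.sum_congr rfl fun m hm => by rw [hsplit m hm]]
  have hlin := listDeriv_sum hU s a (fun m => mderiv m f) (dirList q) (fun m hm => by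
    have := hs m hm
    rw [mderiv_eq_listDeriv]
    refine contDiffOn_listDeriv hU _ (hf.of_le ?_)
    rw [length_dirList, length_dirList]
    exact_mod_cast (by omega)) hx
  have hzero : Set.EqOn (fun x => ∑ m ∈ s, a m * mderiv m f x) (fun _ => 0) U := hPDE
  exact hlin.symm.trans (by rw [listDeriv_eqOn hU hzero _ hx, listDeriv_zero])

end OpenSet
theorem sum_add_coord {d : ℕ} (m n : Fin d → ℕ) :
    ∑ i, (m + n) i = ∑ i, m i + ∑ i, n i :=
  Finset.sum_add_distrib

open Classical in
theorem sum_Mfin_shift {d p : ℕ} {A : Type*} [AddCommMonoid A] (i : Fin d → ℕ)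
    (hi : ∑ k, i k ≤ p) (F : (Fin d → ℕ) → A) :
    ∑ q ∈ Mfin d p, (if i ≤ q then F (q - i) else 0) =
      ∑ k ∈ Mfin d (p - ∑ k, i k), F k := by
  rw [← Finset.sum_filter]
  refine Finset.sum_nbij' (fun q => q - i) (fun k => i + k) ?_ ?_ ?_ ?_ (fun _ _ => rfl)
  · intro q hq
    rw [Finset.mem_filter, mem_Mfin] at hq
    have h := sum_add_coord i (q - i)
    rw [add_tsub_cancel_of_le hq.2] at h
    rw [mem_Mfin]
    omega
  · intro k hk
    rw [mem_Mfin] at hk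
    rw [Finset.mem_filter, mem_Mfin, sum_add_coord]
    exact ⟨by omega, le_self_add⟩
  · intro q hq
    exact add_tsub_cancel_of_le (Finset.mem_filter.1 hq).2
  · intro k _
    exact add_tsub_cancel_left i k

theorem sum_bcoef_mul {d p c : ℕ} (hpc : c ≤ p) (a : (Fin d → ℕ) → ℂ) (r : Fin d → ℕ)
    (hr : ∑ k, r k ≤ p - c) (F : (Fin d → ℕ) → ℂ) :
    ∑ i ∈ Mfin d p, bcoef a c r i * F i = ∑ m ∈ Mfin d c, a m * F (r + m) := by
  classical
  have h := sum_Mfin_shift (p := p) r (by omega)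
    fun m => if m ∈ Mfin d c then a m * F (r + m) else 0
  have hsub : Mfin d c ⊆ Mfin d (p - ∑ k, r k) := by
    intro m hm
    rw [mem_Mfin] at *
    omega
  rw [Finset.sum_ite_mem, Finset.inter_eq_right.2 hsub] at h
  rw [← h]
  refine Finset.sum_congr rfl fun i _ => ?_
  by_cases h₁ : r ≤ i
  · by_cases h₂ : i - r ∈ Mfin d c
    · simp [bcoef, h₁, h₂, add_tsub_cancel_of_le h₁]
    · simp [bcoef, h₂]
  · simp [bcoef, h₁]

/-! ### The graded ordering -/

namespace GradedOrdering

variable {d : ℕ} (ν : GradedOrdering d)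

theorem degree_mono {i j : ℕ+} (h : i ≤ j) : ∑ k, ν.toEquiv i k ≤ ∑ k, ν.toEquiv j k := by
  by_contra! hlt
  exact absurd (ν.graded j i hlt) (not_lt.2 h)

theorem sum_range_Nc {A : Type*} [AddCommMonoid A] (t : ℕ) (F : (Fin d → ℕ) → A) :
    ∑ n ∈ Finset.range (Nc d t), F (ν.toEquiv n.succPNat) = ∑ q ∈ Mfin d t, F q := by
  refine Finset.sum_nbij' (fun n => ν.toEquiv n.succPNat)
    (fun q => (ν.toEquiv.symm q).natPred) ?_ ?_ ?_ ?_ (fun _ _ => rfl)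
  · intro n hn
    rw [mem_Mfin, ← ν.le_Nc_iff, Nat.succPNat_coe]
    exact Finset.mem_range.1 hn
  · intro q hq
    have h : ((ν.toEquiv.symm q : ℕ+) : ℕ) ≤ Nc d t := by
      rw [ν.le_Nc_iff, Equiv.apply_symm_apply]
      exact mem_Mfin.1 hq
    rw [Finset.mem_range, ← Nat.succ_le_iff, ← Nat.succPNat_coe, PNat.succPNat_natPred]
    exact h
  · intro n _
    simp
  · intro q _
    simp

theorem symm_add_lt {m n : Fin d → ℕ} (r : Fin d → ℕ)
    (h : ν.toEquiv.symm m < ν.toEquiv.symm n) :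
    ν.toEquiv.symm (m + r) < ν.toEquiv.symm (n + r) := by
  simpa using ν.compat _ _ (ν.toEquiv.symm r) h

theorem symm_add_le {m n : Fin d → ℕ} (r : Fin d → ℕ)
    (h : ν.toEquiv.symm m ≤ ν.toEquiv.symm n) :
    ν.toEquiv.symm (m + r) ≤ ν.toEquiv.symm (n + r) := by
  rcases h.lt_or_eq with h | h
  · exact (ν.symm_add_lt r h).le
  · rw [ν.toEquiv.symm.injective h]

end GradedOrdering

/-! ### Pivot columns -/

/-- The leading multi-index of the symbol `a`: the largest one in its support. -/
structure IsLeading {d : ℕ} (ν : GradedOrdering d) (a : (Fin d → ℕ) → ℂ) (c : ℕ)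
    (m : Fin d → ℕ) : Prop where
  mem : m ∈ Mfin d c
  ne_zero : a m ≠ 0
  le_of_ne_zero : ∀ n ∈ Mfin d c, a n ≠ 0 → ν.toEquiv.symm n ≤ ν.toEquiv.symm m

theorem exists_isLeading {d c : ℕ} (ν : GradedOrdering d) {a : (Fin d → ℕ) → ℂ}
    (ha : ∃ m ∈ Mfin d c, a m ≠ 0) : ∃ m, IsLeading ν a c m := by
  classical
  obtain ⟨m₀, hm₀, ham₀⟩ := ha
  obtain ⟨m, hm, hmax⟩ := Finset.exists_max_image ((Mfin d c).filter fun m => a m ≠ 0)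
    ν.toEquiv.symm ⟨m₀, Finset.mem_filter.2 ⟨hm₀, ham₀⟩⟩
  rw [Finset.mem_filter] at hm
  exact ⟨m, hm.1, hm.2, fun n hn han => hmax n (Finset.mem_filter.2 ⟨hn, han⟩)⟩

section Pivots

variable {d p c : ℕ} {ν : GradedOrdering d} {a : (Fin d → ℕ) → ℂ} {m : Fin d → ℕ}

theorem bcoef_add (r : Fin d → ℕ) (hm : m ∈ Mfin d c) : bcoef a c r (m + r) = a m := by
  simp [bcoef, hm]

theorem IsLeading.le_of_bcoef_ne_zero (hl : IsLeading ν a c m) {r q : Fin d → ℕ}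
    (h : bcoef a c r q ≠ 0) : ν.toEquiv.symm q ≤ ν.toEquiv.symm (m + r) := by
  unfold bcoef at h
  split_ifs at h with hrq
  · rw [← tsub_add_cancel_of_le hrq.1]
    exact ν.symm_add_le r (hl.le_of_ne_zero _ hrq.2 h)
  · exact absurd rfl h

theorem IsLeading.hIdx_eq (hl : IsLeading ν a c m) (hpc : c ≤ p) {i : ℕ+}
    (hi : (i : ℕ) ≤ Nc d (p - c)) : hIdx a c p ν i = ν.toEquiv.symm (m + ν.toEquiv i) := by
  have hg : IsGreatest {l : ℕ | 0 < l ∧ l ≤ Nc d p ∧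
      bcoef a c (ν.toEquiv i) (ν.toEquiv l.toPNat') ≠ 0}
      (ν.toEquiv.symm (m + ν.toEquiv i) : ℕ+) := by
    refine ⟨⟨PNat.pos _, ?_, ?_⟩, ?_⟩
    · rw [ν.le_Nc_iff] at hi ⊢
      have := mem_Mfin.1 hl.mem
      rw [Equiv.apply_symm_apply, sum_add_coord]
      omega
    · rw [PNat.coe_toPNat', Equiv.apply_symm_apply, bcoef_add _ hl.mem]
      exact hl.ne_zero
    · rintro l ⟨hpos, -, hb⟩
      have := hl.le_of_bcoef_ne_zero hb
      rw [Equiv.symm_apply_apply, ← PNat.coe_le_coe, Nat.toPNat'_coe, if_pos hpos] at this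
      exact this
  rw [hIdx, hg.csSup_eq, PNat.coe_toPNat']

theorem IsLeading.hIdx_fin (hl : IsLeading ν a c m) (hpc : c ≤ p) (r : Fin (Nc d (p - c))) :
    hIdx a c p ν r.val.succPNat = ν.toEquiv.symm (m + ν.toEquiv r.val.succPNat) :=
  hl.hIdx_eq hpc r.2

theorem IsLeading.hIdx_fin_strictMono (hl : IsLeading ν a c m) (hpc : c ≤ p) :
    StrictMono fun r : Fin (Nc d (p - c)) => hIdx a c p ν r.val.succPNat := by
  intro r s hrs
  simp only [hl.hIdx_fin hpc, add_comm m]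
  refine ν.symm_add_lt m ?_
  simpa using hrs

theorem IsLeading.hIdx_fin_le (hl : IsLeading ν a c m) (hpc : c ≤ p) (r : Fin (Nc d (p - c))) :
    (hIdx a c p ν r.val.succPNat : ℕ) ≤ Nc d p := by
  have hr := (ν.le_Nc_iff (p - c) r.val.succPNat).1 r.2
  have := mem_Mfin.1 hl.mem
  rw [hl.hIdx_fin hpc, ν.le_Nc_iff, Equiv.apply_symm_apply, sum_add_coord]
  omega

theorem IsLeading.isUnit_det_Pbar (hl : IsLeading ν a c m) (hpc : c ≤ p) :
    IsUnit (Pbar a c p ν).det := by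
  have htri : (Pbar a c p ν).IsLowerTriangular := by
    intro i j hij
    by_contra hne
    have hle := hl.le_of_bcoef_ne_zero hne
    rw [Equiv.symm_apply_apply, ← hl.hIdx_fin hpc] at hle
    exact absurd ((hl.hIdx_fin_strictMono hpc).le_iff_le.1 hle)
      (not_le.2 (OrderDual.toDual_lt_toDual.1 hij))
  rw [Matrix.det_of_isLowerTriangular _ htri, isUnit_iff_ne_zero, Finset.prod_ne_zero_iff]
  intro r _
  rw [Pbar, Matrix.of_apply, hl.hIdx_fin hpc, Equiv.apply_symm_apply, bcoef_add _ hl.mem]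
  exact hl.ne_zero

theorem mem_barSet_iff {l : ℕ+} :
    l ∈ barSet a c p ν ↔ ∃ r : Fin (Nc d (p - c)), hIdx a c p ν r.val.succPNat = l := by
  constructor
  · rintro ⟨i, hi, rfl⟩
    refine ⟨⟨i.natPred, ?_⟩, ?_⟩
    · rw [← Nat.succ_le_iff, ← Nat.succPNat_coe, PNat.succPNat_natPred]
      exact hi
    · rw [PNat.succPNat_natPred]
  · rintro ⟨r, rfl⟩
    exact ⟨r.val.succPNat, r.2, rfl⟩

open Classical in
theorem IsLeading.Mdec_eq (hl : IsLeading ν a c m) (hpc : c ≤ p) (i : ℕ+) {s : ℕ+}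
    (hs : s ∉ barSet a c p ν) :
    Mdec a c p ν i s = (if i = s then 1 else 0) -
      ∑ r : Fin (Nc d (p - c)), if i = hIdx a c p ν r.val.succPNat then
        ∑ r₂, (Pbar a c p ν)⁻¹ r r₂ * bcoef a c (ν.toEquiv r₂.val.succPNat) (ν.toEquiv s)
      else 0 := by
  unfold Mdec
  by_cases h : ∃ r : Fin (Nc d (p - c)), hIdx a c p ν r.val.succPNat = i
  · have his : i ≠ s := fun he => hs (mem_barSet_iff.2 (he ▸ h))
    have hiff : ∀ r : Fin (Nc d (p - c)), i = hIdx a c p ν r.val.succPNat ↔ r = h.choose := by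
      intro r
      refine ⟨fun hr => (hl.hIdx_fin_strictMono hpc).injective ?_, ?_⟩
      · exact (hr.symm.trans h.choose_spec.symm)
      · rintro rfl
        exact h.choose_spec.symm
    rw [dif_pos h, if_neg his]
    simp only [hiff, Finset.sum_ite_eq', Finset.mem_univ, if_true, zero_sub]
  · rw [dif_neg h, Finset.sum_eq_zero, sub_zero]
    intro r _
    exact if_neg fun hr => h ⟨r, hr.symm⟩

open Classical in
/-- The compressed coefficient vector differs from the original one by an element of the row
space of the coefficient matrix. -/
theorem IsLeading.exists_compressed_eq (hl : IsLeading ν a c m) (hpc : c ≤ p) (α : ℕ+ → ℂ) :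
    ∃ w : Fin (Nc d (p - c)) → ℂ, ∀ s ∈ Finset.range (Nc d p),
      (if s.succPNat ∈ barSet a c p ν then 0 else
        ∑ i ∈ Finset.range (Nc d p), Mdec a c p ν i.succPNat s.succPNat * α i.succPNat) =
      α s.succPNat - ∑ r, w r * bcoef a c (ν.toEquiv r.val.succPNat) (ν.toEquiv s.succPNat) := by
  set h : Fin (Nc d (p - c)) → ℕ+ := fun r => hIdx a c p ν r.val.succPNat with hh
  refine ⟨fun r₂ => ∑ r, α (h r) * (Pbar a c p ν)⁻¹ r r₂, fun s hs => ?_⟩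
  have hswap : ∑ r₂, (∑ r, α (h r) * (Pbar a c p ν)⁻¹ r r₂) *
        bcoef a c (ν.toEquiv r₂.val.succPNat) (ν.toEquiv s.succPNat) =
      ∑ r, α (h r) * ∑ r₂, (Pbar a c p ν)⁻¹ r r₂ *
        bcoef a c (ν.toEquiv r₂.val.succPNat) (ν.toEquiv s.succPNat) := by
    simp only [Finset.sum_mul, Finset.mul_sum, mul_assoc]
    exact Finset.sum_comm
  rw [hswap]
  split_ifs with hbar
  · obtain ⟨j, hj⟩ := mem_barSet_iff.1 hbar
    have hinv : ∀ r, ∑ r₂, (Pbar a c p ν)⁻¹ r r₂ *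
        bcoef a c (ν.toEquiv r₂.val.succPNat) (ν.toEquiv s.succPNat) =
        (1 : Matrix _ _ ℂ) r j := by
      intro r
      rw [← Matrix.nonsing_inv_mul _ (hl.isUnit_det_Pbar hpc), Matrix.mul_apply, ← hj]
      rfl
    simp only [hinv, Matrix.one_apply, mul_ite, mul_one, mul_zero, Finset.sum_ite_eq',
      Finset.mem_univ, if_true]
    rw [hh, ← hj, sub_self]
  · have hsum : ∀ (t : ℕ+) (ht : (t : ℕ) ≤ Nc d p) (x : ℂ),
        ∑ i ∈ Finset.range (Nc d p), (if i.succPNat = t then x else 0) * α i.succPNat =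
          α t * x := by
      intro t ht x
      rw [Finset.sum_eq_single t.natPred]
      · rw [PNat.succPNat_natPred, if_pos rfl, mul_comm]
      · intro i _ hi
        rw [if_neg, zero_mul]
        rintro rfl
        exact hi (by simp)
      · intro hnot
        refine absurd (Finset.mem_range.2 ?_) hnot
        rw [← Nat.succ_le_iff, ← Nat.succPNat_coe, PNat.succPNat_natPred]
        exact ht
    simp only [hl.Mdec_eq hpc _ hbar, sub_mul, Finset.sum_sub_distrib, Finset.sum_mul]
    rw [Finset.sum_comm, hsum s.succPNat (Finset.mem_range.1 hs), mul_one]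
    congr 1
    exact Finset.sum_congr rfl fun r _ => hsum _ (hl.hIdx_fin_le hpc r) _

end Pivots

/-! ### Translation -/

open Classical in
/-- Translating a row of the coefficient matrix yields a functional that vanishes on the
derivatives of solutions. -/
theorem sum_translate_bcoef_eq_zero {d p c : ℕ} (hpc : c ≤ p) {a : (Fin d → ℕ) → ℂ}
    (haeq : ∀ m ∈ Mfin d c, ∑ i, m i < c → a m = 0) (D : (Fin d → ℕ) → ℂ)
    (hD : ∀ q : Fin d → ℕ, ∑ i, q i + c ≤ p → ∑ m ∈ Mfin d c, a m * D (q + m) = 0)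
    (τ : (Fin d → ℕ) → ℂ) (r : Fin d → ℕ) (hr : ∑ k, r k ≤ p - c) :
    ∑ q ∈ Mfin d p, (∑ i ∈ Mfin d p, (if i ≤ q then τ (q - i) else 0) * bcoef a c r i) * D q =
      0 := by
  have hinner : ∀ m ∈ Mfin d c,
      a m * ∑ q ∈ Mfin d p, (if r + m ≤ q then τ (q - (r + m)) else 0) * D q =
      ∑ k ∈ Mfin d (p - c - ∑ j, r j), τ k * (a m * D (r + k + m)) := by
    intro m hm
    rcases (mem_Mfin.1 hm).lt_or_eq with hlt | heq
    · simp [haeq m hm hlt]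
    · have hsum := sum_add_coord r m
      have hshift := sum_Mfin_shift (p := p) (r + m) (by omega)
        fun k => τ k * D (r + m + k)
      rw [show p - ∑ k, (r + m) k = p - c - ∑ j, r j by omega] at hshift
      have hite : ∑ q ∈ Mfin d p, (if r + m ≤ q then τ (q - (r + m)) else 0) * D q =
          ∑ k ∈ Mfin d (p - c - ∑ j, r j), τ k * D (r + m + k) := by
        rw [← hshift]
        refine Finset.sum_congr rfl fun q _ => ?_
        split_ifs with hle
        · rw [add_tsub_cancel_of_le hle]
        · rw [zero_mul]
      rw [hite, Finset.mul_sum]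
      refine Finset.sum_congr rfl fun k _ => ?_
      rw [add_right_comm r m k]
      ring
  calc
    _ = ∑ i ∈ Mfin d p, bcoef a c r i *
          ∑ q ∈ Mfin d p, (if i ≤ q then τ (q - i) else 0) * D q := by
      simp only [Finset.sum_mul, Finset.mul_sum]
      rw [Finset.sum_comm]
      exact Finset.sum_congr rfl fun i _ => Finset.sum_congr rfl fun q _ => by ring
    _ = ∑ m ∈ Mfin d c, ∑ k ∈ Mfin d (p - c - ∑ j, r j), τ k * (a m * D (r + k + m)) := by
      rw [sum_bcoef_mul hpc a r hr]
      exact Finset.sum_congr rfl hinner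
    _ = 0 := by
      rw [Finset.sum_comm]
      refine Finset.sum_eq_zero fun k hk => ?_
      rw [mem_Mfin] at hk
      rw [← Finset.mul_sum, hD (r + k) (by rw [sum_add_coord]; omega), mul_zero]

open Classical in
/-- For a PDE with only terms of equal order `c`, evaluating the
multipole expansion obtained by a multipole-to-multipole translation of the *compressed*
representation (`σ = T E Mᵀ α`) agrees everywhere with evaluating the translation of the
uncompressed representation (`ρ = T α`). -/
theorem m2m_equal_order {d p c : ℕ} (hd : 1 ≤ d) (hc : 1 ≤ c) (hpc : c ≤ p)
    (ν : GradedOrdering d) (a : (Fin d → ℕ) → ℂ)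
    (ha : ∃ m ∈ Mfin d c, (∑ i, m i) = c ∧ a m ≠ 0)
    (haeq : ∀ m ∈ Mfin d c, (∑ i, m i) < c → a m = 0)
    (G : (Fin d → ℝ) → ℂ)
    (hG : ContDiffOn ℝ p G {x : Fin d → ℝ | x ≠ 0})
    (hPDE : ∀ x : Fin d → ℝ, x ≠ 0 → ∑ m ∈ Mfin d c, a m * mderiv m G x = 0)
    (y c₁ c₂ : Fin d → ℝ) :
    ∀ z : Fin d → ℝ, z ≠ 0 →
      (∑ n ∈ Finset.range (Nc d p),
        (∑ i ∈ Finset.range (Nc d p), Tmat ν (c₂ - c₁) n.succPNat i.succPNat *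
          (if i.succPNat ∈ barSet a c p ν then 0 else
            ∑ i' ∈ Finset.range (Nc d p),
              Mdec a c p ν i'.succPNat i.succPNat * alphaVec ν y c₁ i'.succPNat)) *
        mderiv (ν.toEquiv n.succPNat) G z)
      = ∑ n ∈ Finset.range (Nc d p),
          (∑ i ∈ Finset.range (Nc d p), Tmat ν (c₂ - c₁) n.succPNat i.succPNat *
            alphaVec ν y c₁ i.succPNat) *
          mderiv (ν.toEquiv n.succPNat) G z := by
  intro z hz
  obtain ⟨m₀, hm₀, -, ham₀⟩ := ha
  obtain ⟨m, hl⟩ := exists_isLeading ν ⟨m₀, hm₀, ham₀⟩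
  obtain ⟨w, hw⟩ := hl.exists_compressed_eq hpc (alphaVec ν y c₁)
  have hD : ∀ q : Fin d → ℕ, ∑ i, q i + c ≤ p →
      ∑ m ∈ Mfin d c, a m * mderiv (q + m) G z = 0 := fun q hq =>
    sum_mul_mderiv_add_eq_zero isOpen_ne hG (Mfin d c) (fun m hm => mem_Mfin.1 hm) a
      hPDE q hq hz
  have hrow : ∀ r : Fin (Nc d (p - c)), ∑ n ∈ Finset.range (Nc d p),
      (∑ i ∈ Finset.range (Nc d p), Tmat ν (c₂ - c₁) n.succPNat i.succPNat *
        bcoef a c (ν.toEquiv r.val.succPNat) (ν.toEquiv i.succPNat)) *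
      mderiv (ν.toEquiv n.succPNat) G z = 0 := by
    intro r
    set τ : (Fin d → ℕ) → ℂ := fun q =>
      ∏ k, ((((c₂ - c₁) k : ℝ) : ℂ) ^ q k / ((q k).factorial : ℂ)) with hτ
    have h := sum_translate_bcoef_eq_zero hpc haeq (fun q => mderiv q G z) hD τ
      (ν.toEquiv r.val.succPNat) ((ν.le_Nc_iff (p - c) r.val.succPNat).1 r.2)
    rw [← ν.sum_range_Nc] at h
    simp only [← ν.sum_range_Nc p (fun i => (if i ≤ _ then τ (_ - i) else 0) * _)] at h
    exact h
  have hterm : ∀ n : ℕ, (∑ i ∈ Finset.range (Nc d p), Tmat ν (c₂ - c₁) n.succPNat i.succPNat *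
          (if i.succPNat ∈ barSet a c p ν then 0 else
            ∑ i' ∈ Finset.range (Nc d p),
              Mdec a c p ν i'.succPNat i.succPNat * alphaVec ν y c₁ i'.succPNat)) *
        mderiv (ν.toEquiv n.succPNat) G z =
      (∑ i ∈ Finset.range (Nc d p), Tmat ν (c₂ - c₁) n.succPNat i.succPNat *
          alphaVec ν y c₁ i.succPNat) * mderiv (ν.toEquiv n.succPNat) G z -
      ∑ r, w r * ((∑ i ∈ Finset.range (Nc d p), Tmat ν (c₂ - c₁) n.succPNat i.succPNat *
        bcoef a c (ν.toEquiv r.val.succPNat) (ν.toEquiv i.succPNat)) *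
          mderiv (ν.toEquiv n.succPNat) G z) := by
    intro n
    rw [Finset.sum_congr rfl fun i hi => by rw [hw i hi]]
    simp only [mul_sub, Finset.sum_sub_distrib, sub_mul, Finset.mul_sum, Finset.sum_mul]
    rw [Finset.sum_comm (s := Finset.range (Nc d p)) (t := Finset.univ)]
    congr 1
    exact Finset.sum_congr rfl fun r _ => Finset.sum_congr rfl fun i _ => by ring
  rw [Finset.sum_congr rfl fun n _ => hterm n, Finset.sum_sub_distrib, Finset.sum_comm]
  simp only [← Finset.mul_sum, hrow, mul_zero, Finset.sum_const_zero, sub_zero]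
end

section
/- Let u(x,y,z) = 1/√(x² + y² + z²), defined on ℝ³ ∖ {(0,0,0)}. Then for all integers n ≥ 2, m ≥ 2, l ≥ 2 and every (x,y,z) ≠ (0,0,0): (x² + y² + z²) · ∂^{n+m+l}u/∂xⁿ∂yᵐ∂zˡ = −(2n−1)·x · ∂^{n+m+l−1}u/∂x^{n−1}∂yᵐ∂zˡ − (n−1)² · ∂^{n+m+l−2}u/∂x^{n−2}∂yᵐ∂zˡ − 2m·y · ∂^{n+m+l−1}u/∂xⁿ∂y^{m−1}∂zˡ − m(m−1) · ∂^{n+m+l−2}u/∂xⁿ∂y^{m−2}∂zˡ − 2l·z · ∂^{n+m+l−1}u/∂xⁿ∂yᵐ∂z^{l−1} − l(l−1) · ∂^{n+m+l−2}u/∂xⁿ∂yᵐ∂z^{l−2}. -/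
/-- Partial derivative with respect to the first variable. -/
noncomputable def dX3 (f : ℝ → ℝ → ℝ → ℝ) : ℝ → ℝ → ℝ → ℝ :=
  fun x y z => deriv (fun s => f s y z) x

/-- Partial derivative with respect to the second variable. -/
noncomputable def dY3 (f : ℝ → ℝ → ℝ → ℝ) : ℝ → ℝ → ℝ → ℝ :=
  fun x y z => deriv (fun s => f x s z) y

/-- Partial derivative with respect to the third variable. -/
noncomputable def dZ3 (f : ℝ → ℝ → ℝ → ℝ) : ℝ → ℝ → ℝ → ℝ :=
  fun x y z => deriv (fun s => f x y s) z

/-- The 3D Laplace kernel `u(x,y,z) = 1/√(x² + y² + z²)`. -/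
noncomputable def uLap3 : ℝ → ℝ → ℝ → ℝ :=
  fun x y z => 1 / Real.sqrt (x ^ 2 + y ^ 2 + z ^ 2)

open scoped ContDiff

/-- `f` is smooth, as a function of three variables, away from the origin. -/
def SmoothOffOrigin (f : ℝ → ℝ → ℝ → ℝ) : Prop :=
  ∀ p : ℝ × ℝ × ℝ, p ≠ 0 → ContDiffAt ℝ ∞ (fun q : ℝ × ℝ × ℝ => f q.1 q.2.1 q.2.2) p

/-- The directional derivative of `F` along `v`. -/
noncomputable def dirDeriv (v : ℝ × ℝ × ℝ) (F : ℝ × ℝ × ℝ → ℝ) : ℝ × ℝ × ℝ → ℝ :=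
  fun q => fderiv ℝ F q v

theorem contDiffAt_dirDeriv {F : ℝ × ℝ × ℝ → ℝ} {p : ℝ × ℝ × ℝ} (hF : ContDiffAt ℝ ∞ F p)
    (v : ℝ × ℝ × ℝ) : ContDiffAt ℝ ∞ (dirDeriv v F) p :=
  (hF.fderiv_right (m := ∞) (by simp)).clm_apply contDiffAt_const

theorem dirDeriv_comm {F : ℝ × ℝ × ℝ → ℝ} {p : ℝ × ℝ × ℝ} (hF : ContDiffAt ℝ ∞ F p)
    (v w : ℝ × ℝ × ℝ) : dirDeriv v (dirDeriv w F) p = dirDeriv w (dirDeriv v F) p := by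
  have hd : DifferentiableAt ℝ (fderiv ℝ F) p :=
    (hF.fderiv_right (m := ∞) (by simp)).differentiableAt (by simp)
  have key : ∀ a b : ℝ × ℝ × ℝ, dirDeriv a (dirDeriv b F) p = fderiv ℝ (fderiv ℝ F) p a b := by
    intro a b
    have := (hd.hasFDerivAt.clm_apply (hasFDerivAt_const b p)).fderiv
    change fderiv ℝ (fun q => fderiv ℝ F q b) p a = _
    rw [this]
    simp
  rw [key, key]
  exact (hF.isSymmSndFDerivAt (by simpa using ENat.LEInfty.out)) v w

theorem eventually_ne_origin {p : ℝ × ℝ × ℝ} (hp : p ≠ 0) : ∀ᶠ q in nhds p, q ≠ 0 :=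
  isOpen_ne.mem_nhds hp

namespace SmoothOffOrigin

variable {f : ℝ → ℝ → ℝ → ℝ}

theorem hasDerivAt_line (hf : SmoothOffOrigin f) {γ : ℝ → ℝ × ℝ × ℝ} {v : ℝ × ℝ × ℝ} {t : ℝ}
    (hγ : HasDerivAt γ v t) (h0 : γ t ≠ 0) :
    HasDerivAt (fun s => f (γ s).1 (γ s).2.1 (γ s).2.2)
      (dirDeriv v (fun q => f q.1 q.2.1 q.2.2) (γ t)) t :=
  ((hf _ h0).differentiableAt (by simp)).hasFDerivAt.comp_hasDerivAt t hγ

theorem dX3_eq (hf : SmoothOffOrigin f) {p : ℝ × ℝ × ℝ} (hp : p ≠ 0) :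
    dX3 f p.1 p.2.1 p.2.2 = dirDeriv (1, 0, 0) (fun q => f q.1 q.2.1 q.2.2) p :=
  (hf.hasDerivAt_line (γ := fun s => (s, p.2.1, p.2.2)) (t := p.1)
    ((hasDerivAt_id _).prodMk (hasDerivAt_const _ _)) hp).deriv

theorem dY3_eq (hf : SmoothOffOrigin f) {p : ℝ × ℝ × ℝ} (hp : p ≠ 0) :
    dY3 f p.1 p.2.1 p.2.2 = dirDeriv (0, 1, 0) (fun q => f q.1 q.2.1 q.2.2) p :=
  (hf.hasDerivAt_line (γ := fun s => (p.1, s, p.2.2)) (t := p.2.1)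
    ((hasDerivAt_const _ _).prodMk ((hasDerivAt_id _).prodMk (hasDerivAt_const _ _))) hp).deriv

theorem dZ3_eq (hf : SmoothOffOrigin f) {p : ℝ × ℝ × ℝ} (hp : p ≠ 0) :
    dZ3 f p.1 p.2.1 p.2.2 = dirDeriv (0, 0, 1) (fun q => f q.1 q.2.1 q.2.2) p :=
  (hf.hasDerivAt_line (γ := fun s => (p.1, p.2.1, s)) (t := p.2.2)
    ((hasDerivAt_const _ _).prodMk ((hasDerivAt_const _ _).prodMk (hasDerivAt_id _))) hp).deriv

theorem of_eq_dirDeriv (hf : SmoothOffOrigin f) {g : ℝ → ℝ → ℝ → ℝ} {v : ℝ × ℝ × ℝ}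
    (h : ∀ p : ℝ × ℝ × ℝ, p ≠ 0 →
      g p.1 p.2.1 p.2.2 = dirDeriv v (fun q => f q.1 q.2.1 q.2.2) p) : SmoothOffOrigin g :=
  fun p hp => (contDiffAt_dirDeriv (hf p hp) v).congr_of_eventuallyEq
    ((eventually_ne_origin hp).mono h)

end SmoothOffOrigin

/-- Two functions of three variables agree away from the origin. -/
def EqOffOrigin (f g : ℝ → ℝ → ℝ → ℝ) : Prop :=
  ∀ p : ℝ × ℝ × ℝ, p ≠ 0 → f p.1 p.2.1 p.2.2 = g p.1 p.2.1 p.2.2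

theorem EqOffOrigin.dirDeriv_eq {f g : ℝ → ℝ → ℝ → ℝ} (h : EqOffOrigin f g) (v : ℝ × ℝ × ℝ)
    {p : ℝ × ℝ × ℝ} (hp : p ≠ 0) :
    dirDeriv v (fun q => f q.1 q.2.1 q.2.2) p = dirDeriv v (fun q => g q.1 q.2.1 q.2.2) p :=
  DFunLike.congr_fun (Filter.EventuallyEq.fderiv_eq ((eventually_ne_origin hp).mono h)) v

/-- An operator acting on functions smooth off the origin as a directional derivative. -/
structure IsDirOp (T : (ℝ → ℝ → ℝ → ℝ) → ℝ → ℝ → ℝ → ℝ) (v : ℝ × ℝ × ℝ) : Prop where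
  eq_dirDeriv : ∀ {f : ℝ → ℝ → ℝ → ℝ}, SmoothOffOrigin f → ∀ p : ℝ × ℝ × ℝ, p ≠ 0 →
    T f p.1 p.2.1 p.2.2 = dirDeriv v (fun q => f q.1 q.2.1 q.2.2) p

theorem isDirOp_dX3 : IsDirOp dX3 (1, 0, 0) := ⟨fun hf _ => hf.dX3_eq⟩

theorem isDirOp_dY3 : IsDirOp dY3 (0, 1, 0) := ⟨fun hf _ => hf.dY3_eq⟩

theorem isDirOp_dZ3 : IsDirOp dZ3 (0, 0, 1) := ⟨fun hf _ => hf.dZ3_eq⟩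

namespace IsDirOp

variable {S T : (ℝ → ℝ → ℝ → ℝ) → ℝ → ℝ → ℝ → ℝ} {v w : ℝ × ℝ × ℝ} {f g : ℝ → ℝ → ℝ → ℝ}

theorem smooth (hT : IsDirOp T v) (hf : SmoothOffOrigin f) : SmoothOffOrigin (T f) :=
  hf.of_eq_dirDeriv (hT.eq_dirDeriv hf)

theorem smooth_iterate (hT : IsDirOp T v) (hf : SmoothOffOrigin f) (n : ℕ) :
    SmoothOffOrigin (T^[n] f) :=
  Function.Iterate.rec _ hf (fun _ => hT.smooth) n

theorem congr (hT : IsDirOp T v) (hf : SmoothOffOrigin f) (hg : SmoothOffOrigin g)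
    (h : EqOffOrigin f g) : EqOffOrigin (T f) (T g) := fun p hp => by
  rw [hT.eq_dirDeriv hf p hp, hT.eq_dirDeriv hg p hp, h.dirDeriv_eq v hp]

theorem comm (hS : IsDirOp S v) (hT : IsDirOp T w) (hf : SmoothOffOrigin f) :
    EqOffOrigin (S (T f)) (T (S f)) := fun p hp => by
  have h₁ := EqOffOrigin.dirDeriv_eq (f := T f)
    (g := fun x y z => dirDeriv w (fun q => f q.1 q.2.1 q.2.2) (x, y, z))
    (hT.eq_dirDeriv hf) v hp
  have h₂ := EqOffOrigin.dirDeriv_eq (f := S f)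
    (g := fun x y z => dirDeriv v (fun q => f q.1 q.2.1 q.2.2) (x, y, z))
    (hS.eq_dirDeriv hf) w hp
  rw [hS.eq_dirDeriv (hT.smooth hf) p hp, hT.eq_dirDeriv (hS.smooth hf) p hp, h₁, h₂]
  exact dirDeriv_comm (hf p hp) v w

theorem comm_iterate (hS : IsDirOp S v) (hT : IsDirOp T w) (hf : SmoothOffOrigin f) (n : ℕ) :
    EqOffOrigin (S (T^[n] f)) (T^[n] (S f)) := by
  induction n with
  | zero => exact fun _ _ => rfl
  | succ n ih =>
    intro p hp
    rw [Function.iterate_succ_apply', Function.iterate_succ_apply',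
      hS.comm hT (hT.smooth_iterate hf n) p hp]
    exact hT.congr (hS.smooth (hT.smooth_iterate hf n)) (hT.smooth_iterate (hS.smooth hf) n) ih p hp

theorem congr_iterate (hT : IsDirOp T v) (hf : SmoothOffOrigin f) (hg : SmoothOffOrigin g)
    (h : EqOffOrigin f g) (n : ℕ) : EqOffOrigin (T^[n] f) (T^[n] g) := by
  induction n with
  | zero => exact h
  | succ n ih =>
    rw [Function.iterate_succ_apply', Function.iterate_succ_apply']
    exact hT.congr (hT.smooth_iterate hf n) (hT.smooth_iterate hg n) ih

end IsDirOp

theorem sq_sum_pos {p : ℝ × ℝ × ℝ} (hp : p ≠ 0) : 0 < p.1 ^ 2 + p.2.1 ^ 2 + p.2.2 ^ 2 := by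
  by_contra! h
  refine hp (Prod.ext ?_ (Prod.ext ?_ ?_)) <;> simp only [Prod.fst_zero, Prod.snd_zero] <;>
    nlinarith [sq_nonneg p.1, sq_nonneg p.2.1, sq_nonneg p.2.2]

theorem smooth_uLap3 : SmoothOffOrigin uLap3 := by
  intro p hp
  have h := (sq_sum_pos hp).ne'
  refine ContDiffAt.div contDiffAt_const (ContDiffAt.sqrt (by fun_prop) h) ?_
  exact (Real.sqrt_pos.2 (sq_sum_pos hp)).ne'

/-- The mixed partial derivative of `uLap3` of order `n`, `m`, `l` in the three variables. -/
noncomputable def lapDeriv (n m l : ℕ) : ℝ → ℝ → ℝ → ℝ :=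
  dX3^[n] (dY3^[m] (dZ3^[l] uLap3))

theorem smooth_lapDeriv (n m l : ℕ) : SmoothOffOrigin (lapDeriv n m l) :=
  isDirOp_dX3.smooth_iterate (isDirOp_dY3.smooth_iterate
    (isDirOp_dZ3.smooth_iterate smooth_uLap3 l) m) n

theorem dirDeriv_x_lapDeriv (n m l : ℕ) {p : ℝ × ℝ × ℝ} (hp : p ≠ 0) :
    dirDeriv (1, 0, 0) (fun q => lapDeriv n m l q.1 q.2.1 q.2.2) p =
      lapDeriv (n + 1) m l p.1 p.2.1 p.2.2 := by
  rw [← (smooth_lapDeriv n m l).dX3_eq hp, lapDeriv, lapDeriv, Function.iterate_succ_apply']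

theorem dirDeriv_y_lapDeriv (n m l : ℕ) {p : ℝ × ℝ × ℝ} (hp : p ≠ 0) :
    dirDeriv (0, 1, 0) (fun q => lapDeriv n m l q.1 q.2.1 q.2.2) p =
      lapDeriv n (m + 1) l p.1 p.2.1 p.2.2 := by
  have hz := isDirOp_dZ3.smooth_iterate smooth_uLap3 l
  rw [← (smooth_lapDeriv n m l).dY3_eq hp, lapDeriv, lapDeriv, Function.iterate_succ_apply']
  exact isDirOp_dY3.comm_iterate isDirOp_dX3 (isDirOp_dY3.smooth_iterate hz m) n p hp

theorem dirDeriv_z_lapDeriv (n m l : ℕ) {p : ℝ × ℝ × ℝ} (hp : p ≠ 0) :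
    dirDeriv (0, 0, 1) (fun q => lapDeriv n m l q.1 q.2.1 q.2.2) p =
      lapDeriv n m (l + 1) p.1 p.2.1 p.2.2 := by
  have hz := isDirOp_dZ3.smooth_iterate smooth_uLap3 l
  have hy := isDirOp_dY3.smooth_iterate hz m
  rw [← (smooth_lapDeriv n m l).dZ3_eq hp, lapDeriv, lapDeriv, Function.iterate_succ_apply',
    isDirOp_dZ3.comm_iterate isDirOp_dX3 hy n p hp]
  exact isDirOp_dX3.congr_iterate (isDirOp_dZ3.smooth hy)
    (isDirOp_dY3.smooth_iterate (isDirOp_dZ3.smooth hz) m)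
    (isDirOp_dZ3.comm_iterate isDirOp_dY3 hz m) n p hp

theorem hasDerivAt_lapDeriv_x (n m l : ℕ) {x y z : ℝ} (hp : (x, y, z) ≠ 0) :
    HasDerivAt (fun s => lapDeriv n m l s y z) (lapDeriv (n + 1) m l x y z) x :=
  dirDeriv_x_lapDeriv n m l hp ▸ (smooth_lapDeriv n m l).hasDerivAt_line
    (γ := fun s => (s, y, z)) ((hasDerivAt_id x).prodMk (hasDerivAt_const _ _)) hp

theorem hasDerivAt_lapDeriv_y (n m l : ℕ) {x y z : ℝ} (hp : (x, y, z) ≠ 0) :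
    HasDerivAt (fun s => lapDeriv n m l x s z) (lapDeriv n (m + 1) l x y z) y :=
  dirDeriv_y_lapDeriv n m l hp ▸ (smooth_lapDeriv n m l).hasDerivAt_line
    (γ := fun s => (x, s, z)) ((hasDerivAt_const _ _).prodMk
      ((hasDerivAt_id y).prodMk (hasDerivAt_const _ _))) hp

theorem hasDerivAt_lapDeriv_z (n m l : ℕ) {x y z : ℝ} (hp : (x, y, z) ≠ 0) :
    HasDerivAt (fun s => lapDeriv n m l x y s) (lapDeriv n m (l + 1) x y z) z :=
  dirDeriv_z_lapDeriv n m l hp ▸ (smooth_lapDeriv n m l).hasDerivAt_line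
    (γ := fun s => (x, y, s)) ((hasDerivAt_const _ _).prodMk
      ((hasDerivAt_const _ _).prodMk (hasDerivAt_id z))) hp

/-- The defect of the recurrence at order `(n + 1, m, l)`; it vanishes off the origin. -/
noncomputable def recDefect (n m l : ℕ) (x y z : ℝ) : ℝ :=
  (x ^ 2 + y ^ 2 + z ^ 2) * lapDeriv (n + 1) m l x y z
    + (2 * n + 1) * (x * lapDeriv n m l x y z) + n ^ 2 * lapDeriv (n - 1) m l x y z
    + 2 * m * (y * lapDeriv (n + 1) (m - 1) l x y z)
    + m * (m - 1) * lapDeriv (n + 1) (m - 2) l x y z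
    + 2 * l * (z * lapDeriv (n + 1) m (l - 1) x y z)
    + l * (l - 1) * lapDeriv (n + 1) m (l - 2) x y z

theorem recDefect_zero {x y z : ℝ} (hp : (x, y, z) ≠ 0) : recDefect 0 0 0 x y z = 0 := by
  have hpos : 0 < x ^ 2 + y ^ 2 + z ^ 2 := sq_sum_pos hp
  have hr := Real.sqrt_pos.2 hpos
  have hd : HasDerivAt (fun s => 1 / √(s ^ 2 + y ^ 2 + z ^ 2))
      (-(x / (√(x ^ 2 + y ^ 2 + z ^ 2)) ^ 3)) x := by
    have h := ((((hasDerivAt_pow 2 x).add_const (y ^ 2)).add_const (z ^ 2)).sqrt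
      hpos.ne').fun_inv hr.ne'
    simp only [one_div]
    refine h.congr_deriv ?_
    field_simp
    simp
  have h1 : lapDeriv 1 0 0 x y z = -(x / (√(x ^ 2 + y ^ 2 + z ^ 2)) ^ 3) := hd.deriv
  have h0 : lapDeriv 0 0 0 x y z = 1 / √(x ^ 2 + y ^ 2 + z ^ 2) := rfl
  simp only [recDefect, zero_add, h1, h0]
  nth_rewrite 1 [← Real.sq_sqrt hpos.le]
  field_simp
  simp

theorem recDefect_succ_x {n m l : ℕ} {x y z : ℝ} (hp : (x, y, z) ≠ 0) :
    HasDerivAt (fun s => recDefect n m l s y z) (recDefect (n + 1) m l x y z) x := by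
  have hD := fun n m l => hasDerivAt_lapDeriv_x n m l hp
  have h := (((((((((hasDerivAt_pow 2 x).add_const (y ^ 2)).add_const (z ^ 2)).fun_mul
    (hD (n + 1) m l)).fun_add
    (((hasDerivAt_id' x).fun_mul (hD n m l)).const_mul (2 * (n : ℝ) + 1))).fun_add
    ((hD (n - 1) m l).const_mul ((n : ℝ) ^ 2))).fun_add
    (((hD (n + 1) (m - 1) l).const_mul y).const_mul (2 * (m : ℝ)))).fun_add
    ((hD (n + 1) (m - 2) l).const_mul ((m : ℝ) * (m - 1)))).fun_add
    (((hD (n + 1) m (l - 1)).const_mul z).const_mul (2 * (l : ℝ)))).fun_add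
    ((hD (n + 1) m (l - 2)).const_mul ((l : ℝ) * (l - 1)))
  refine h.congr_deriv ?_
  rcases n with _ | n <;> simp [recDefect] <;> ring

theorem recDefect_succ_y {n m l : ℕ} {x y z : ℝ} (hp : (x, y, z) ≠ 0) :
    HasDerivAt (fun s => recDefect n m l x s z) (recDefect n (m + 1) l x y z) y := by
  have hD := fun n m l => hasDerivAt_lapDeriv_y n m l hp
  have h := (((((((((hasDerivAt_pow 2 y).const_add (x ^ 2)).add_const (z ^ 2)).fun_mul
    (hD (n + 1) m l)).fun_add
    (((hD n m l).const_mul x).const_mul (2 * (n : ℝ) + 1))).fun_add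
    ((hD (n - 1) m l).const_mul ((n : ℝ) ^ 2))).fun_add
    (((hasDerivAt_id' y).fun_mul (hD (n + 1) (m - 1) l)).const_mul (2 * (m : ℝ)))).fun_add
    ((hD (n + 1) (m - 2) l).const_mul ((m : ℝ) * (m - 1)))).fun_add
    (((hD (n + 1) m (l - 1)).const_mul z).const_mul (2 * (l : ℝ)))).fun_add
    ((hD (n + 1) m (l - 2)).const_mul ((l : ℝ) * (l - 1)))
  refine h.congr_deriv ?_
  rcases m with _ | _ | m <;> simp [recDefect] <;> ring

theorem recDefect_succ_z {n m l : ℕ} {x y z : ℝ} (hp : (x, y, z) ≠ 0) :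
    HasDerivAt (fun s => recDefect n m l x y s) (recDefect n m (l + 1) x y z) z := by
  have hD := fun n m l => hasDerivAt_lapDeriv_z n m l hp
  have h := ((((((((hasDerivAt_pow 2 z).const_add (x ^ 2 + y ^ 2)).fun_mul
    (hD (n + 1) m l)).fun_add
    (((hD n m l).const_mul x).const_mul (2 * (n : ℝ) + 1))).fun_add
    ((hD (n - 1) m l).const_mul ((n : ℝ) ^ 2))).fun_add
    (((hD (n + 1) (m - 1) l).const_mul y).const_mul (2 * (m : ℝ)))).fun_add
    ((hD (n + 1) (m - 2) l).const_mul ((m : ℝ) * (m - 1)))).fun_add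
    (((hasDerivAt_id' z).fun_mul (hD (n + 1) m (l - 1))).const_mul (2 * (l : ℝ)))).fun_add
    ((hD (n + 1) m (l - 2)).const_mul ((l : ℝ) * (l - 1)))
  refine h.congr_deriv ?_
  rcases l with _ | _ | l <;> simp [recDefect] <;> ring

theorem eq_zero_of_hasDerivAt_line {g : ℝ × ℝ × ℝ → ℝ} (hg : ∀ p, p ≠ 0 → g p = 0)
    {γ : ℝ → ℝ × ℝ × ℝ} {t c : ℝ} (hγ : ContinuousAt γ t) (h0 : γ t ≠ 0)
    (h : HasDerivAt (fun s => g (γ s)) c t) : c = 0 :=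
  h.unique ((hasDerivAt_const t (0 : ℝ)).congr_of_eventuallyEq
    ((hγ.eventually (eventually_ne_origin h0)).mono fun _ => hg _))

theorem recDefect_eq_zero (n m l : ℕ) :
    ∀ p : ℝ × ℝ × ℝ, p ≠ 0 → recDefect n m l p.1 p.2.1 p.2.2 = 0 := by
  induction n with
  | succ n ih =>
    rintro ⟨x, y, z⟩ hp
    exact eq_zero_of_hasDerivAt_line ih (γ := fun s => (s, y, z)) (by fun_prop) hp
      (recDefect_succ_x hp)
  | zero =>
    induction m with
    | succ m ih =>
      rintro ⟨x, y, z⟩ hp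
      exact eq_zero_of_hasDerivAt_line ih (γ := fun s => (x, s, z)) (by fun_prop) hp
        (recDefect_succ_y hp)
    | zero =>
      induction l with
      | succ l ih =>
        rintro ⟨x, y, z⟩ hp
        exact eq_zero_of_hasDerivAt_line ih (γ := fun s => (x, y, s)) (by fun_prop) hp
          (recDefect_succ_z hp)
      | zero => exact fun _ hp => recDefect_zero hp

/-- Recurrence for the derivatives of `u = 1/r`
(`r = √(x²+y²+z²)`): for all `n, m, l ≥ 2` and `(x,y,z) ≠ (0,0,0)`,
`r² ∂^{n+m+l}u/∂xⁿ∂yᵐ∂zˡ = −(2n−1)x ∂/∂x^{n−1}… − (n−1)² ∂/∂x^{n−2}…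
 − 2my ∂/∂y^{m−1}… − m(m−1) ∂/∂y^{m−2}… − 2lz ∂/∂z^{l−1}… − l(l−1) ∂/∂z^{l−2}…`. -/
theorem laplace3d_deriv_recurrence :
    ∀ n m l : ℕ, 2 ≤ n → 2 ≤ m → 2 ≤ l → ∀ x y z : ℝ, (x, y, z) ≠ (0, 0, 0) →
      (x ^ 2 + y ^ 2 + z ^ 2) * (dX3^[n] (dY3^[m] (dZ3^[l] uLap3))) x y z =
        -((2 * (n : ℝ) - 1) * x) * (dX3^[n - 1] (dY3^[m] (dZ3^[l] uLap3))) x y z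
        - ((n : ℝ) - 1) ^ 2 * (dX3^[n - 2] (dY3^[m] (dZ3^[l] uLap3))) x y z
        - 2 * (m : ℝ) * y * (dX3^[n] (dY3^[m - 1] (dZ3^[l] uLap3))) x y z
        - (m : ℝ) * ((m : ℝ) - 1) * (dX3^[n] (dY3^[m - 2] (dZ3^[l] uLap3))) x y z
        - 2 * (l : ℝ) * z * (dX3^[n] (dY3^[m] (dZ3^[l - 1] uLap3))) x y z
        - (l : ℝ) * ((l : ℝ) - 1) * (dX3^[n] (dY3^[m] (dZ3^[l - 2] uLap3))) x y z := by
  rintro n m l hn - - x y z hp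
  obtain ⟨n, rfl⟩ := Nat.exists_eq_add_of_le' (show 1 ≤ n by lia)
  have h := recDefect_eq_zero n m l (x, y, z) hp
  simp only [recDefect, lapDeriv] at h
  rw [show n + 1 - 2 = n - 1 by lia, Nat.add_sub_cancel]
  push_cast
  linear_combination h
end
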